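/- arXiv:2001.05306 — 2 statements merged into one kernel-verified Lean document; each statement's English description precedes it below -/
import Mathlib

section
/- In a Carnicer-Gasca lattice X of degree n (a GC_n set with exactly n+1 maximal lines), if a line ℓ passes through exactly k ≥ 2 of the 1_m-nodes, then the ℓ-lowering X̂ is a Chung-Yao lattice of degree k−1 in which ℓ is a maximal line; consequently ℓ is used by exactly k(k−1)/2 nodes of X. -/
attribute [local instance] Classical.propDecidable

/-- Evaluate a bivariate polynomial at a point of the plane. -/
noncomputable def evalPt (p : MvPolynomial (Fin 2) ℝ) (A : ℝ × ℝ) : ℝ :=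
  MvPolynomial.eval ![A.1, A.2] p

/-- A (polynomial defining a) line: a bivariate polynomial of total degree exactly 1. -/
def IsLinearPoly (l : MvPolynomial (Fin 2) ℝ) : Prop := l.totalDegree = 1

/-- A point lies on the line defined by `l`. -/
def OnLine (l : MvPolynomial (Fin 2) ℝ) (A : ℝ × ℝ) : Prop := evalPt l A = 0

/-- Two degree-1 polynomials define the same line (same zero set). -/
def SameLine (l₁ l₂ : MvPolynomial (Fin 2) ℝ) : Prop := ∀ P, OnLine l₁ P ↔ OnLine l₂ P

/-- `X` is an `n`-correct set of nodes in the plane. -/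
def NCorrect (n : ℕ) (X : Finset (ℝ × ℝ)) : Prop :=
  X.card = (n + 2) * (n + 1) / 2 ∧
  ∀ c : (ℝ × ℝ) → ℝ, ∃! p : MvPolynomial (Fin 2) ℝ,
    p.totalDegree ≤ n ∧ ∀ A ∈ X, evalPt p A = c A

/-- `p` is the `n`-fundamental polynomial of node `A` in `X`. -/
def IsFundamental (n : ℕ) (X : Finset (ℝ × ℝ)) (A : ℝ × ℝ)
    (p : MvPolynomial (Fin 2) ℝ) : Prop :=
  p.totalDegree ≤ n ∧ evalPt p A = 1 ∧ ∀ B ∈ X, B ≠ A → evalPt p B = 0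

/-- Node `A` of `X` uses line `l`. -/
def Uses (n : ℕ) (X : Finset (ℝ × ℝ)) (A : ℝ × ℝ) (l : MvPolynomial (Fin 2) ℝ) : Prop :=
  ∃ p, IsFundamental n X A p ∧ l ∣ p

/-- The set of nodes of `X` using the line `l` (the set `Xˡ`). -/
noncomputable def UsedSet (n : ℕ) (X : Finset (ℝ × ℝ)) (l : MvPolynomial (Fin 2) ℝ) :
    Finset (ℝ × ℝ) := X.filter (fun A => Uses n X A l)

/-- `l` is a maximal line of `X`: a line passing through exactly `n+1` nodes. -/
def IsMaximalLine (n : ℕ) (X : Finset (ℝ × ℝ)) (l : MvPolynomial (Fin 2) ℝ) : Prop :=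
  IsLinearPoly l ∧ (X.filter (fun A => OnLine l A)).card = n + 1

/-- `X` is a `GC_n` set. -/
def GCSet (n : ℕ) (X : Finset (ℝ × ℝ)) : Prop :=
  NCorrect n X ∧
  ∀ A ∈ X, ∃ f : Fin n → MvPolynomial (Fin 2) ℝ,
    (∀ i, IsLinearPoly (f i)) ∧ IsFundamental n X A (∏ i, f i)

/-- `L` is a set of representatives (one per line) of all maximal lines of `X`. -/
def MaximalLinesRep (n : ℕ) (X : Finset (ℝ × ℝ))
    (L : Finset (MvPolynomial (Fin 2) ℝ)) : Prop :=
  (∀ l ∈ L, IsMaximalLine n X l) ∧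
  (∀ l₁ ∈ L, ∀ l₂ ∈ L, SameLine l₁ l₂ → l₁ = l₂) ∧
  (∀ l, IsMaximalLine n X l → ∃ l' ∈ L, SameLine l l')

/-- A maximal line `lam` is `l`-disjoint: it meets `l` at no node of `X`. -/
def IsDisjointMax (n : ℕ) (X : Finset (ℝ × ℝ)) (l lam : MvPolynomial (Fin 2) ℝ) : Prop :=
  IsMaximalLine n X lam ∧ ∀ A ∈ X, ¬(OnLine lam A ∧ OnLine l A)

/-- A maximal line `lam` is a member of a pair of `l`-adjoint maximal lines. -/
def IsAdjointMax (n : ℕ) (X : Finset (ℝ × ℝ)) (l lam : MvPolynomial (Fin 2) ℝ) : Prop :=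
  IsMaximalLine n X lam ∧ ∃ lam', IsMaximalLine n X lam' ∧ ¬SameLine lam lam' ∧
    ∃ A ∈ X, OnLine lam A ∧ OnLine lam' A ∧ OnLine l A

/-- The `l`-lowering `X̂(l)` of `X`. -/
noncomputable def Lowering (n : ℕ) (X : Finset (ℝ × ℝ)) (l : MvPolynomial (Fin 2) ℝ) :
    Finset (ℝ × ℝ) :=
  X.filter (fun A => ¬ ∃ lam, (IsDisjointMax n X l lam ∨ IsAdjointMax n X l lam) ∧ OnLine lam A)

/-- A node `A` is a `1_m`-node of `X` w.r.t. the maximal-line representatives `L`: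
it lies on exactly one maximal line. -/
def Is1mNode (L : Finset (MvPolynomial (Fin 2) ℝ)) (A : ℝ × ℝ) : Prop :=
  (L.filter (fun l => OnLine l A)).card = 1

/-- `k` lines in general position: no two parallel (any two meet in exactly one point),
no three concurrent. -/
def InGenPos (k : ℕ) (f : Fin k → MvPolynomial (Fin 2) ℝ) : Prop :=
  (∀ i, IsLinearPoly (f i)) ∧
  (∀ i j, i ≠ j → ∃! P : ℝ × ℝ, OnLine (f i) P ∧ OnLine (f j) P) ∧
  (∀ i j m, i ≠ j → j ≠ m → i ≠ m →
    ¬ ∃ P : ℝ × ℝ, OnLine (f i) P ∧ OnLine (f j) P ∧ OnLine (f m) P)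

/-- `X` is a Chung-Yao lattice of degree `m`. -/
def IsChungYao (m : ℕ) (X : Finset (ℝ × ℝ)) : Prop :=
  ∃ f : Fin (m + 2) → MvPolynomial (Fin 2) ℝ, InGenPos (m + 2) f ∧
    ∀ P : ℝ × ℝ, P ∈ X ↔ ∃ i j, i ≠ j ∧ OnLine (f i) P ∧ OnLine (f j) P
theorem SameLine.symm {l m : MvPolynomial (Fin 2) ℝ} (h : SameLine l m) : SameLine m l :=
  fun P => (h P).symm

theorem SameLine.trans {l m r : MvPolynomial (Fin 2) ℝ} (hlm : SameLine l m) (hmr : SameLine m r) :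
    SameLine l r :=
  fun P => (hlm P).trans (hmr P)

/-- A polynomial of total degree one is an affine form with nonzero linear part. -/
theorem IsLinearPoly.exists_eq {l : MvPolynomial (Fin 2) ℝ} (hl : IsLinearPoly l) :
    ∃ a b c : ℝ, (a ≠ 0 ∨ b ≠ 0) ∧
      l = MvPolynomial.C a * MvPolynomial.X 0 + MvPolynomial.C b * MvPolynomial.X 1
        + MvPolynomial.C c := by
  have hform : l = MvPolynomial.C (l.coeff (Finsupp.single 0 1)) * MvPolynomial.X 0
      + MvPolynomial.C (l.coeff (Finsupp.single 1 1)) * MvPolynomial.X 1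
      + MvPolynomial.C (l.coeff 0) := by
    ext m
    simp only [MvPolynomial.coeff_add, MvPolynomial.coeff_C_mul, MvPolynomial.coeff_X,
      MvPolynomial.coeff_C]
    have h01 : (Finsupp.single 0 1 : Fin 2 →₀ ℕ) ≠ Finsupp.single 1 1 := by
      intro h; simpa using DFunLike.congr_fun h 0
    have h0 : (0 : Fin 2 →₀ ℕ) ≠ Finsupp.single 0 1 := by
      intro h; simpa using DFunLike.congr_fun h 0
    have h1 : (0 : Fin 2 →₀ ℕ) ≠ Finsupp.single 1 1 := by
      intro h; simpa using DFunLike.congr_fun h 1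
    by_cases e0 : m = 0
    · subst e0; simp [h0.symm, h1.symm]
    by_cases ex : m = Finsupp.single 0 1
    · subst ex; simp [h01.symm, h0]
    by_cases ey : m = Finsupp.single 1 1
    · subst ey; simp [h01, h1]
    · rw [if_neg (Ne.symm ex), if_neg (Ne.symm ey), if_neg (Ne.symm e0)]
      have : l.coeff m = 0 := by
        apply MvPolynomial.coeff_eq_zero_of_totalDegree_lt
        rw [show l.totalDegree = 1 from hl]
        have hs : ∑ i ∈ m.support, m i = m 0 + m 1 := by
          rw [← Fin.sum_univ_two (f := fun i => m i)]
          exact Finset.sum_subset (Finset.subset_univ _) (by simp)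
        rw [hs]
        by_contra hle
        have hcases : (m 0 = 0 ∧ m 1 = 0) ∨ (m 0 = 1 ∧ m 1 = 0) ∨ (m 0 = 0 ∧ m 1 = 1) := by
          omega
        rcases hcases with ⟨p, q⟩ | ⟨p, q⟩ | ⟨p, q⟩
        · exact e0 (by ext i; fin_cases i <;> simp [p, q])
        · exact ex (by ext i; fin_cases i <;> simp [p, q])
        · exact ey (by ext i; fin_cases i <;> simp [p, q])
      simp [this]
  refine ⟨_, _, _, ?_, hform⟩
  by_contra! hcon
  rw [hcon.1, hcon.2] at hform
  have hdeg : l.totalDegree = 1 := hl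
  rw [hform] at hdeg
  simp at hdeg

theorem onLine_affine (a b c : ℝ) (P : ℝ × ℝ) :
    OnLine (MvPolynomial.C a * MvPolynomial.X 0 + MvPolynomial.C b * MvPolynomial.X 1
      + MvPolynomial.C c) P ↔ a * P.1 + b * P.2 + c = 0 := by
  simp [OnLine, evalPt]

theorem IsLinearPoly.exists_onLine_iff {l : MvPolynomial (Fin 2) ℝ} (hl : IsLinearPoly l) :
    ∃ a b c : ℝ, (a ≠ 0 ∨ b ≠ 0) ∧ ∀ P, OnLine l P ↔ a * P.1 + b * P.2 + c = 0 := by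
  obtain ⟨a, b, c, hab, rfl⟩ := hl.exists_eq
  exact ⟨a, b, c, hab, onLine_affine a b c⟩

/-- A line contains arbitrarily large finite sets of points. -/
theorem IsLinearPoly.exists_finset_onLine {l : MvPolynomial (Fin 2) ℝ} (hl : IsLinearPoly l)
    (N : ℕ) : ∃ T : Finset (ℝ × ℝ), T.card = N ∧ ∀ P ∈ T, OnLine l P := by
  obtain ⟨a, b, c, hab, h⟩ := hl.exists_onLine_iff
  have hpos : a ^ 2 + b ^ 2 ≠ 0 := by
    rcases hab with h | h <;> positivity
  let g : ℕ → ℝ × ℝ := fun t =>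
    (-a * c / (a ^ 2 + b ^ 2) - b * t, -b * c / (a ^ 2 + b ^ 2) + a * t)
  have hg : Function.Injective g := by
    intro s t hst
    have h1 := congrArg Prod.fst hst
    have h2 := congrArg Prod.snd hst
    simp only [g] at h1 h2
    rcases hab with h | h
    · have : (s : ℝ) = t := mul_left_cancel₀ h (by linarith)
      exact_mod_cast this
    · have : (s : ℝ) = t := mul_left_cancel₀ h (by linarith)
      exact_mod_cast this
  refine ⟨(Finset.range N).image g, ?_, ?_⟩
  · rw [Finset.card_image_of_injective _ hg, Finset.card_range]
  · intro P hP
    obtain ⟨t, -, rfl⟩ := Finset.mem_image.1 hP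
    rw [h]
    simp only [g]
    field_simp
    ring

theorem cross_eq_zero {a b c x y x' y' : ℝ} (hP : a * x + b * y + c = 0)
    (hQ : a * x' + b * y' + c = 0) : a * (x - x') + b * (y - y') = 0 := by
  linarith

/-- Two distinct points determine a line: any further point of one line lies on the other. -/
theorem OnLine.of_two_points {l m : MvPolynomial (Fin 2) ℝ} (hl : IsLinearPoly l)
    (hm : IsLinearPoly m) {P Q R : ℝ × ℝ} (hPQ : P ≠ Q) (hPl : OnLine l P) (hQl : OnLine l Q)
    (hPm : OnLine m P) (hQm : OnLine m Q) (hR : OnLine l R) : OnLine m R := by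
  obtain ⟨a, b, c, hab, h⟩ := hl.exists_onLine_iff
  obtain ⟨a', b', c', -, h'⟩ := hm.exists_onLine_iff
  rw [h] at hPl hQl hR
  rw [h'] at hPm hQm ⊢
  have e1 := cross_eq_zero hQl hPl
  have e2 := cross_eq_zero hQm hPm
  have e3 := cross_eq_zero hR hPl
  have hdet : a * b' - a' * b = 0 := by
    by_contra hne
    apply hPQ
    have hx : (a * b' - a' * b) * (Q.1 - P.1) = 0 := by linear_combination b' * e1 - b * e2
    have hy : (a * b' - a' * b) * (Q.2 - P.2) = 0 := by linear_combination a * e2 - a' * e1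
    have hx' := (mul_eq_zero.1 hx).resolve_left hne
    have hy' := (mul_eq_zero.1 hy).resolve_left hne
    exact Prod.ext (by linarith) (by linarith)
  rcases hab with ha | hb
  · have : a * (a' * R.1 + b' * R.2 + c') = 0 := by
      linear_combination a * hPm + a' * e3 + (R.2 - P.2) * hdet
    exact (mul_eq_zero.1 this).resolve_left ha
  · have : b * (a' * R.1 + b' * R.2 + c') = 0 := by
      linear_combination b * hPm + b' * e3 - (R.1 - P.1) * hdet
    exact (mul_eq_zero.1 this).resolve_left hb

theorem sameLine_of_two_points {l m : MvPolynomial (Fin 2) ℝ} (hl : IsLinearPoly l)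
    (hm : IsLinearPoly m) {P Q : ℝ × ℝ} (hPQ : P ≠ Q) (hPl : OnLine l P) (hQl : OnLine l Q)
    (hPm : OnLine m P) (hQm : OnLine m Q) : SameLine l m :=
  fun _ => ⟨OnLine.of_two_points hl hm hPQ hPl hQl hPm hQm,
    OnLine.of_two_points hm hl hPQ hPm hQm hPl hQl⟩

/-- Distinct lines meet in at most one point. -/
theorem eq_of_not_sameLine {l m : MvPolynomial (Fin 2) ℝ} (hl : IsLinearPoly l)
    (hm : IsLinearPoly m) (h : ¬ SameLine l m) {P Q : ℝ × ℝ} (hPl : OnLine l P)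
    (hPm : OnLine m P) (hQl : OnLine l Q) (hQm : OnLine m Q) : P = Q := by
  by_contra hPQ
  exact h (sameLine_of_two_points hl hm hPQ hPl hQl hPm hQm)

/-- Linear polynomials with the same zero set are associated. -/
theorem SameLine.dvd {l m : MvPolynomial (Fin 2) ℝ} (h : SameLine l m) (hl : IsLinearPoly l)
    (hm : IsLinearPoly m) : l ∣ m := by
  obtain ⟨a, b, c, hab, rfl⟩ := hl.exists_eq
  obtain ⟨a', b', c', -, rfl⟩ := hm.exists_eq
  simp only [SameLine, onLine_affine] at h
  have hpos : a ^ 2 + b ^ 2 ≠ 0 := by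
    rcases hab with h | h <;> positivity
  have h0 := (h (-a * c / (a ^ 2 + b ^ 2), -b * c / (a ^ 2 + b ^ 2))).1 (by field_simp; ring)
  have h1 := (h (-a * c / (a ^ 2 + b ^ 2) - b, -b * c / (a ^ 2 + b ^ 2) + a)).1
    (by field_simp; ring)
  simp only at h0 h1
  have hdet : a' * b = b' * a := by linear_combination h0 - h1
  field_simp at h0
  refine ⟨MvPolynomial.C ((a * a' + b * b') / (a ^ 2 + b ^ 2)), ?_⟩
  have ea : a' = a * ((a * a' + b * b') / (a ^ 2 + b ^ 2)) := by
    field_simp; linear_combination b * hdet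
  have eb : b' = b * ((a * a' + b * b') / (a ^ 2 + b ^ 2)) := by
    field_simp; linear_combination -a * hdet
  have ec : c' = c * ((a * a' + b * b') / (a ^ 2 + b ^ 2)) := by
    field_simp; linear_combination h0
  set r := (a * a' + b * b') / (a ^ 2 + b ^ 2)
  conv_lhs => rw [ea, eb, ec]
  simp only [MvPolynomial.C_mul]
  ring

/-- If more than `#S` points of a line are covered by the lines indexed by `S`, then one of
these lines is the given one. -/
theorem exists_sameLine_of_card_lt {ι : Type*} {S : Finset ι}
    {f : ι → MvPolynomial (Fin 2) ℝ} (hf : ∀ i, IsLinearPoly (f i))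
    {l : MvPolynomial (Fin 2) ℝ} (hl : IsLinearPoly l) {T : Finset (ℝ × ℝ)}
    (hT : ∀ P ∈ T, OnLine l P) (hcard : S.card < T.card)
    (hcover : ∀ P ∈ T, ∃ i ∈ S, OnLine (f i) P) : ∃ i ∈ S, SameLine (f i) l := by
  obtain ⟨P₀, hP₀⟩ := Finset.card_pos.1 (Nat.zero_lt_of_lt hcard)
  have : Nonempty ι := ⟨(hcover P₀ hP₀).choose⟩
  choose! g hgS hg using hcover
  obtain ⟨P, hP, Q, hQ, hPQ, hgPQ⟩ :=
    Finset.exists_ne_map_eq_of_card_lt_of_maps_to hcard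
      (fun P hP => Finset.mem_coe.2 (hgS P hP))
  exact ⟨g P, hgS P hP, sameLine_of_two_points (hf _) hl hPQ (hg P hP) (hgPQ ▸ hg Q hQ)
    (hT P hP) (hT Q hQ)⟩

/-- The lines `f` cover all nodes of `X` except `A`. -/
structure CoversExcept (n : ℕ) (X : Finset (ℝ × ℝ)) (A : ℝ × ℝ)
    (f : Fin n → MvPolynomial (Fin 2) ℝ) : Prop where
  linear : ∀ i, IsLinearPoly (f i)
  not_onLine : ∀ i, ¬ OnLine (f i) A
  cover : ∀ B ∈ X, B ≠ A → ∃ i, OnLine (f i) B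

theorem evalPt_prod {ι : Type*} (s : Finset ι) (f : ι → MvPolynomial (Fin 2) ℝ) (A : ℝ × ℝ) :
    evalPt (∏ i ∈ s, f i) A = ∏ i ∈ s, evalPt (f i) A :=
  map_prod _ _ _

theorem IsFundamental.coversExcept {n : ℕ} {X : Finset (ℝ × ℝ)} {A : ℝ × ℝ}
    {f : Fin n → MvPolynomial (Fin 2) ℝ} (hf : ∀ i, IsLinearPoly (f i))
    (h : IsFundamental n X A (∏ i, f i)) : CoversExcept n X A f := by
  obtain ⟨-, h1, h0⟩ := h
  refine ⟨hf, fun i hi => ?_, fun B hB hBA => ?_⟩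
  · have hi' : evalPt (f i) A = 0 := hi
    rw [evalPt_prod, Finset.prod_eq_zero (Finset.mem_univ i) hi'] at h1
    exact zero_ne_one h1
  · have := h0 B hB hBA
    rw [evalPt_prod, Finset.prod_eq_zero_iff] at this
    obtain ⟨i, -, hi⟩ := this
    exact ⟨i, hi⟩

theorem GCSet.exists_coversExcept {n : ℕ} {X : Finset (ℝ × ℝ)} (hX : GCSet n X) {A : ℝ × ℝ}
    (hA : A ∈ X) : ∃ f, CoversExcept n X A f := by
  obtain ⟨f, hf, h⟩ := hX.2 A hA
  exact ⟨f, h.coversExcept hf⟩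

theorem NCorrect.eq_of_isFundamental {n : ℕ} {X : Finset (ℝ × ℝ)} (hX : NCorrect n X)
    {A : ℝ × ℝ} {p q : MvPolynomial (Fin 2) ℝ} (hp : IsFundamental n X A p)
    (hq : IsFundamental n X A q) : p = q := by
  refine (hX.2 (fun B => if B = A then 1 else 0)).unique ⟨hp.1, fun B hB => ?_⟩
    ⟨hq.1, fun B hB => ?_⟩
  · split_ifs with h
    · exact h ▸ hp.2.1
    · exact hp.2.2 B hB h
  · split_ifs with h
    · exact h ▸ hq.2.1
    · exact hq.2.2 B hB h

/-- In a `GC_n` set, a node uses a line iff the line is one of those covering the other nodes. -/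
theorem GCSet.exists_coversExcept_uses_iff {n : ℕ} {X : Finset (ℝ × ℝ)} (hX : GCSet n X)
    {A : ℝ × ℝ} (hA : A ∈ X) : ∃ f, CoversExcept n X A f ∧
      ∀ l, IsLinearPoly l → (Uses n X A l ↔ ∃ i, SameLine (f i) l) := by
  obtain ⟨f, hf, h⟩ := hX.2 A hA
  refine ⟨f, h.coversExcept hf, fun l hl => ⟨?_, ?_⟩⟩
  · rintro ⟨p, hp, hlp⟩
    rw [hX.1.eq_of_isFundamental hp h] at hlp
    obtain ⟨q, hq⟩ := hlp
    obtain ⟨T, hTcard, hT⟩ := hl.exists_finset_onLine (n + 1)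
    obtain ⟨i, -, hi⟩ := exists_sameLine_of_card_lt (S := Finset.univ) hf hl hT
      (by rw [hTcard, Finset.card_univ, Fintype.card_fin]; exact Nat.lt_succ_self n)
      (fun P hP => by
        have h0 : evalPt (∏ i, f i) P = 0 := by
          have hlP : evalPt l P = 0 := hT P hP
          have hmul : evalPt (l * q) P = evalPt l P * evalPt q P := map_mul _ _ _
          rw [hq, hmul, hlP, zero_mul]
        rwa [evalPt_prod, Finset.prod_eq_zero_iff] at h0)
    exact ⟨i, hi⟩
  · rintro ⟨i, hi⟩
    exact ⟨_, h, (hi.symm.dvd hl (hf i)).trans (Finset.dvd_prod_of_mem f (Finset.mem_univ i))⟩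

/-- A maximal line missing the node `A` belongs to every family of `n` lines covering the other
nodes. -/
theorem CoversExcept.exists_sameLine {n : ℕ} {X : Finset (ℝ × ℝ)} {A : ℝ × ℝ}
    {f : Fin n → MvPolynomial (Fin 2) ℝ} (hf : CoversExcept n X A f)
    {u : MvPolynomial (Fin 2) ℝ} (hu : IsMaximalLine n X u) (hA : ¬ OnLine u A) :
    ∃ i, SameLine (f i) u := by
  obtain ⟨i, -, hi⟩ := exists_sameLine_of_card_lt (S := Finset.univ) hf.linear hu.1
    (T := X.filter (fun B => OnLine u B)) (fun P hP => (Finset.mem_filter.1 hP).2)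
    (by rw [hu.2, Finset.card_univ, Fintype.card_fin]; exact Nat.lt_succ_self n)
    (fun P hP => by
      obtain ⟨hPX, hPu⟩ := Finset.mem_filter.1 hP
      obtain ⟨i, hi⟩ := hf.cover P hPX (by rintro rfl; exact hA hPu)
      exact ⟨i, Finset.mem_univ i, hi⟩)
  exact ⟨i, hi⟩

/-- Two maximal lines of a `GC_n` set meet in a node. -/
theorem GCSet.exists_node_onLine {n : ℕ} {X : Finset (ℝ × ℝ)} (hX : GCSet n X)
    {u v : MvPolynomial (Fin 2) ℝ} (hu : IsMaximalLine n X u) (hv : IsMaximalLine n X v) :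
    ∃ P ∈ X, OnLine u P ∧ OnLine v P := by
  by_contra! hcon
  obtain ⟨A, hA⟩ : (X.filter (fun B => OnLine v B)).Nonempty := by
    rw [← Finset.card_pos, hv.2]; exact Nat.succ_pos n
  have hA' := Finset.mem_filter.1 hA
  obtain ⟨f, hf⟩ := hX.exists_coversExcept hA'.1
  obtain ⟨i₀, hi₀⟩ := hf.exists_sameLine hu (fun h => hcon A hA'.1 h hA'.2)
  obtain ⟨i, -, hi⟩ := exists_sameLine_of_card_lt (S := Finset.univ.erase i₀) hf.linear hv.1
    (T := (X.filter (fun B => OnLine v B)).erase A)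
    (fun P hP => (Finset.mem_filter.1 (Finset.mem_of_mem_erase hP)).2)
    (by
      rw [Finset.card_erase_of_mem hA, hv.2, Finset.card_erase_of_mem (Finset.mem_univ _),
        Finset.card_univ, Fintype.card_fin]
      have := i₀.pos
      omega)
    (fun P hP => by
      obtain ⟨hPA, hP⟩ := Finset.mem_erase.1 hP
      obtain ⟨hPX, hPv⟩ := Finset.mem_filter.1 hP
      obtain ⟨i, hi⟩ := hf.cover P hPX hPA
      refine ⟨i, Finset.mem_erase.2 ⟨?_, Finset.mem_univ i⟩, hi⟩
      rintro rfl
      exact hcon P hPX ((hi₀ P).1 hi) hPv)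
  exact absurd ((hi A).2 hA'.2) (hf.not_onLine i)

/-- Three distinct maximal lines of a `GC_n` set are not concurrent. -/
theorem GCSet.not_concurrent {n : ℕ} (hn : 1 ≤ n) {X : Finset (ℝ × ℝ)} (hX : GCSet n X)
    {u v w : MvPolynomial (Fin 2) ℝ} (hu : IsMaximalLine n X u) (hv : IsMaximalLine n X v)
    (hw : IsMaximalLine n X w) (huv : ¬ SameLine u v) (huw : ¬ SameLine u w)
    (hvw : ¬ SameLine v w) {P : ℝ × ℝ} (hPu : OnLine u P) (hPv : OnLine v P) :
    ¬ OnLine w P := by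
  intro hPw
  have hPX : P ∈ X := by
    obtain ⟨Q, hQX, hQu, hQv⟩ := hX.exists_node_onLine hu hv
    rwa [eq_of_not_sameLine hu.1 hv.1 huv hPu hPv hQu hQv]
  obtain ⟨B, hB, hBP⟩ := Finset.exists_mem_ne
    (by rw [hw.2]; omega : 1 < (X.filter (fun B => OnLine w B)).card) P
  have hB' := Finset.mem_filter.1 hB
  obtain ⟨f, hf⟩ := hX.exists_coversExcept hB'.1
  obtain ⟨i₁, hi₁⟩ := hf.exists_sameLine hu
    (fun h => hBP (eq_of_not_sameLine hu.1 hw.1 huw h hB'.2 hPu hPw))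
  obtain ⟨i₂, hi₂⟩ := hf.exists_sameLine hv
    (fun h => hBP (eq_of_not_sameLine hv.1 hw.1 hvw h hB'.2 hPv hPw))
  have hi₁₂ : i₂ ≠ i₁ := by
    rintro rfl
    exact huv (hi₁.symm.trans hi₂)
  have hPmem : P ∈ (X.filter (fun B => OnLine w B)).erase B :=
    Finset.mem_erase.2 ⟨hBP.symm, Finset.mem_filter.2 ⟨hPX, hPw⟩⟩
  have hi₂mem : i₂ ∈ (Finset.univ : Finset (Fin n)).erase i₁ :=
    Finset.mem_erase.2 ⟨hi₁₂, Finset.mem_univ _⟩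
  obtain ⟨i, -, hi⟩ := exists_sameLine_of_card_lt
    (S := (Finset.univ.erase i₁).erase i₂) hf.linear hw.1
    (T := ((X.filter (fun B => OnLine w B)).erase B).erase P)
    (fun Q hQ => (Finset.mem_filter.1 (Finset.mem_of_mem_erase (Finset.mem_of_mem_erase hQ))).2)
    (by
      have := Finset.card_pos.2 ⟨i₂, hi₂mem⟩
      rw [Finset.card_erase_of_mem hi₂mem, Finset.card_erase_of_mem hPmem]
      rw [Finset.card_erase_of_mem (Finset.mem_univ _), Finset.card_univ,
        Fintype.card_fin] at this ⊢
      rw [Finset.card_erase_of_mem hB, hw.2]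
      omega)
    (fun Q hQ => by
      obtain ⟨hQP, hQ⟩ := Finset.mem_erase.1 hQ
      obtain ⟨hQB, hQ⟩ := Finset.mem_erase.1 hQ
      obtain ⟨hQX, hQw⟩ := Finset.mem_filter.1 hQ
      obtain ⟨i, hi⟩ := hf.cover Q hQX hQB
      refine ⟨i, Finset.mem_erase.2 ⟨?_, Finset.mem_erase.2 ⟨?_, Finset.mem_univ i⟩⟩, hi⟩
      · rintro rfl
        exact hQP (eq_of_not_sameLine hv.1 hw.1 hvw ((hi₂ Q).1 hi) hQw hPv hPw)
      · rintro rfl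
        exact hQP (eq_of_not_sameLine hu.1 hw.1 huw ((hi₁ Q).1 hi) hQw hPu hPw))
  exact absurd ((hi B).2 hB'.2) (hf.not_onLine i)

/-- The incidence structure of a Carnicer-Gasca lattice `X` with maximal lines `L`; `a u` is the
only node on `u` that lies on no other maximal line. -/
structure CarnicerGascaIncidence (X : Finset (ℝ × ℝ)) (L : Finset (MvPolynomial (Fin 2) ℝ))
    (a : MvPolynomial (Fin 2) ℝ → ℝ × ℝ) : Prop where
  linear : ∀ u ∈ L, IsLinearPoly u
  eq_of_sameLine : ∀ u ∈ L, ∀ v ∈ L, SameLine u v → u = v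
  meet : ∀ u ∈ L, ∀ v ∈ L, ∃ P ∈ X, OnLine u P ∧ OnLine v P
  eq_or_eq : ∀ u ∈ L, ∀ v ∈ L, u ≠ v → ∀ P, OnLine u P → OnLine v P →
    ∀ w ∈ L, OnLine w P → w = u ∨ w = v
  cover : ∀ P ∈ X, ∃ u ∈ L, OnLine u P
  mem : ∀ u ∈ L, a u ∈ X
  onLine : ∀ u ∈ L, OnLine u (a u)
  eq_of_onLine : ∀ u ∈ L, ∀ v ∈ L, OnLine v (a u) → v = u
  eq_node : ∀ u ∈ L, ∀ P ∈ X, OnLine u P → (∀ v ∈ L, OnLine v P → v = u) → P = a u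

/-- A `GC_n` set with `n+1` maximal lines has the incidence structure of a Carnicer-Gasca
lattice. -/
theorem GCSet.exists_carnicerGascaIncidence {n : ℕ} (hn : 1 ≤ n) {X : Finset (ℝ × ℝ)}
    (hX : GCSet n X) {L : Finset (MvPolynomial (Fin 2) ℝ)} (hL : MaximalLinesRep n X L)
    (hcard : L.card = n + 1) : ∃ a, CarnicerGascaIncidence X L a := by
  obtain ⟨hmax, hinj, -⟩ := hL
  have hne : ∀ u ∈ L, ∀ v ∈ L, u ≠ v → ¬ SameLine u v := fun u hu v hv huv h =>
    huv (hinj u hu v hv h)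
  have htwo : ∀ u ∈ L, ∀ v ∈ L, u ≠ v → ∀ P, OnLine u P → OnLine v P →
      ∀ w ∈ L, OnLine w P → w = u ∨ w = v := by
    intro u hu v hv huv P hPu hPv w hw hPw
    by_contra! hcon
    exact hX.not_concurrent hn (hmax u hu) (hmax v hv) (hmax w hw) (hne u hu v hv huv)
      (hne u hu w hw hcon.1.symm) (hne v hv w hw hcon.2.symm) hPu hPv hPw
  have hnode : ∀ u ∈ L, ∃ A ∈ X, OnLine u A ∧ (∀ v ∈ L, OnLine v A → v = u) ∧
      ∀ P ∈ X, OnLine u P → (∀ v ∈ L, OnLine v P → v = u) → P = A := by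
    intro u hu
    have hmeet : ∀ v ∈ L, ∃ P ∈ X, OnLine u P ∧ OnLine v P := fun v hv =>
      hX.exists_node_onLine (hmax u hu) (hmax v hv)
    choose! m hmX hmu hmv using hmeet
    have hsub : (L.erase u).image m ⊆ X.filter (fun B => OnLine u B) := by
      intro P hP
      obtain ⟨v, hv, rfl⟩ := Finset.mem_image.1 hP
      have hv' := Finset.mem_of_mem_erase hv
      exact Finset.mem_filter.2 ⟨hmX v hv', hmu v hv'⟩
    have himage : ((L.erase u).image m).card = n := by
      rw [Finset.card_image_of_injOn, Finset.card_erase_of_mem hu, hcard, Nat.add_sub_cancel]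
      intro v hv w hw hvw
      obtain ⟨hvu, hv⟩ := Finset.mem_erase.1 hv
      obtain ⟨hwu, hw⟩ := Finset.mem_erase.1 hw
      have hw' := hmv w hw
      rw [← hvw] at hw'
      exact ((htwo u hu v hv hvu.symm (m v) (hmu v hv) (hmv v hv) w hw hw').resolve_left
        hwu).symm
    have hone : (X.filter (fun B => OnLine u B) \ (L.erase u).image m).card = 1 := by
      rw [Finset.card_sdiff_of_subset hsub, himage, (hmax u hu).2]
      omega
    have hmem : ∀ P, P ∈ X.filter (fun B => OnLine u B) \ (L.erase u).image m ↔
        P ∈ X ∧ OnLine u P ∧ ∀ v ∈ L, OnLine v P → v = u := by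
      intro P
      simp only [Finset.mem_sdiff, Finset.mem_filter, Finset.mem_image, Finset.mem_erase]
      constructor
      · rintro ⟨⟨hPX, hPu⟩, hP⟩
        refine ⟨hPX, hPu, fun v hv hPv => ?_⟩
        by_contra hvu
        exact hP ⟨v, ⟨hvu, hv⟩, eq_of_not_sameLine (hmax u hu).1 (hmax v hv).1
          (hne u hu v hv (Ne.symm hvu)) (hmu v hv) (hmv v hv) hPu hPv⟩
      · rintro ⟨hPX, hPu, hP⟩
        refine ⟨⟨hPX, hPu⟩, ?_⟩
        rintro ⟨v, ⟨hvu, hv⟩, rfl⟩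
        exact hvu (hP v hv (hmv v hv))
    obtain ⟨A, hA⟩ := Finset.card_eq_one.1 hone
    rw [hA] at hmem
    have hAA := (hmem A).1 (Finset.mem_singleton_self A)
    exact ⟨A, hAA.1, hAA.2.1, hAA.2.2, fun P h1 h2 h3 =>
      Finset.mem_singleton.1 ((hmem P).2 ⟨h1, h2, h3⟩)⟩
  choose! a haX hau hauniq haeq using hnode
  refine ⟨a, fun u hu => (hmax u hu).1, hinj,
    fun u hu v hv => hX.exists_node_onLine (hmax u hu) (hmax v hv), htwo, ?_, haX, hau, hauniq,
    haeq⟩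
  intro P hP
  by_contra! hcon
  obtain ⟨f, hf⟩ := hX.exists_coversExcept hP
  have hfac : ∀ u ∈ L, ∃ i, SameLine (f i) u := fun u hu =>
    hf.exists_sameLine (hmax u hu) (hcon u hu)
  have : Nonempty (Fin n) := ⟨⟨0, hn⟩⟩
  choose! g hg using hfac
  obtain ⟨u, hu, v, hv, huv, hguv⟩ := Finset.exists_ne_map_eq_of_card_lt_of_maps_to
    (s := L) (t := (Finset.univ : Finset (Fin n))) (f := g)
    (by rw [hcard, Finset.card_univ, Fintype.card_fin]; exact Nat.lt_succ_self n)
    (fun u _ => Finset.mem_coe.2 (Finset.mem_univ _))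
  have hgv := hg v hv
  rw [← hguv] at hgv
  exact hne u hu v hv huv ((hg u hu).symm.trans hgv)

namespace CarnicerGascaIncidence

variable {X : Finset (ℝ × ℝ)} {L : Finset (MvPolynomial (Fin 2) ℝ)}
  {a : MvPolynomial (Fin 2) ℝ → ℝ × ℝ}

theorem point_eq (h : CarnicerGascaIncidence X L a) {u v : MvPolynomial (Fin 2) ℝ} (hu : u ∈ L)
    (hv : v ∈ L) (huv : u ≠ v) {P Q : ℝ × ℝ} (hPu : OnLine u P) (hPv : OnLine v P)
    (hQu : OnLine u Q) (hQv : OnLine v Q) : P = Q :=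
  eq_of_not_sameLine (h.linear u hu) (h.linear v hv)
    (fun hs => huv (h.eq_of_sameLine u hu v hv hs)) hPu hPv hQu hQv

theorem mem_of_onLine (h : CarnicerGascaIncidence X L a) {u v : MvPolynomial (Fin 2) ℝ}
    (hu : u ∈ L) (hv : v ∈ L) (huv : u ≠ v) {P : ℝ × ℝ} (hPu : OnLine u P)
    (hPv : OnLine v P) : P ∈ X := by
  obtain ⟨Q, hQX, hQu, hQv⟩ := h.meet u hu v hv
  rwa [h.point_eq hu hv huv hPu hPv hQu hQv]

theorem injOn (h : CarnicerGascaIncidence X L a) : Set.InjOn a L := by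
  intro u hu v hv huv
  have := h.onLine u hu
  rw [huv] at this
  exact h.eq_of_onLine v hv u hu this

theorem is1mNode_iff (h : CarnicerGascaIncidence X L a) {P : ℝ × ℝ} (hP : P ∈ X) :
    Is1mNode L P ↔ ∃ u ∈ L, P = a u := by
  rw [Is1mNode, Finset.card_eq_one]
  constructor
  · rintro ⟨u, hu⟩
    have hmem : ∀ v, v ∈ L ∧ OnLine v P ↔ v = u := fun v => by
      rw [← Finset.mem_singleton, ← hu, Finset.mem_filter]
    obtain ⟨huL, huP⟩ := (hmem u).2 rfl
    exact ⟨u, huL, h.eq_node u huL P hP huP fun v hv hvP => (hmem v).1 ⟨hv, hvP⟩⟩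
  · rintro ⟨u, hu, rfl⟩
    refine ⟨u, ?_⟩
    ext v
    rw [Finset.mem_filter, Finset.mem_singleton]
    exact ⟨fun hv => h.eq_of_onLine u hu v hv.1 hv.2, by rintro rfl; exact ⟨hu, h.onLine _ hu⟩⟩

theorem filter_eq_image (h : CarnicerGascaIncidence X L a) (l : MvPolynomial (Fin 2) ℝ) :
    X.filter (fun A => OnLine l A ∧ Is1mNode L A) =
      (L.filter (fun u => OnLine l (a u))).image a := by
  ext P
  simp only [Finset.mem_filter, Finset.mem_image]
  constructor
  · rintro ⟨hPX, hPl, hP⟩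
    obtain ⟨u, hu, rfl⟩ := (h.is1mNode_iff hPX).1 hP
    exact ⟨u, ⟨hu, hPl⟩, rfl⟩
  · rintro ⟨u, ⟨hu, hul⟩, rfl⟩
    exact ⟨h.mem u hu, hul, (h.is1mNode_iff (h.mem u hu)).2 ⟨u, hu, rfl⟩⟩

theorem card_filter_eq (h : CarnicerGascaIncidence X L a) (l : MvPolynomial (Fin 2) ℝ) :
    (X.filter (fun A => OnLine l A ∧ Is1mNode L A)).card =
      (L.filter (fun u => OnLine l (a u))).card := by
  rw [h.filter_eq_image, Finset.card_image_of_injOn]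
  exact h.injOn.mono (Finset.coe_subset.2 (Finset.filter_subset _ _))

/-- A line through two `1_m`-nodes is not a maximal line. -/
theorem not_sameLine (h : CarnicerGascaIncidence X L a) {l : MvPolynomial (Fin 2) ℝ}
    (hk : 2 ≤ (L.filter (fun u => OnLine l (a u))).card) : ∀ u ∈ L, ¬ SameLine l u := by
  intro u hu hs
  obtain ⟨v, hv, hvu⟩ := Finset.exists_mem_ne hk u
  obtain ⟨hvL, hvl⟩ := Finset.mem_filter.1 hv
  exact hvu (h.eq_of_onLine v hvL u hu ((hs _).1 hvl)).symm

theorem eq_node_of_onLine (h : CarnicerGascaIncidence X L a) {l : MvPolynomial (Fin 2) ℝ}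
    (hl : IsLinearPoly l) (hne : ∀ u ∈ L, ¬ SameLine l u) {u : MvPolynomial (Fin 2) ℝ}
    (hu : u ∈ L) (hul : OnLine l (a u)) {P : ℝ × ℝ} (hPl : OnLine l P) (hPu : OnLine u P) :
    P = a u :=
  eq_of_not_sameLine hl (h.linear u hu) (hne u hu) hPl hPu hul (h.onLine u hu)

/-- The nodes of the `l`-lowering are those lying only on maximal lines whose `1_m`-node is on
`l`. -/
theorem mem_lowering_iff (h : CarnicerGascaIncidence X L a) {n : ℕ}
    (hL : MaximalLinesRep n X L) {l : MvPolynomial (Fin 2) ℝ} (hl : IsLinearPoly l)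
    (hne : ∀ u ∈ L, ¬ SameLine l u) (P : ℝ × ℝ) :
    P ∈ Lowering n X l ↔ P ∈ X ∧ ∀ u ∈ L, OnLine u P → OnLine l (a u) := by
  rw [Lowering, Finset.mem_filter]
  refine and_congr_right fun hPX => ⟨fun hP u hu hPu => ?_, ?_⟩
  · by_contra hul
    refine hP ⟨u, ?_, hPu⟩
    by_cases hdis : ∀ A ∈ X, ¬(OnLine u A ∧ OnLine l A)
    · exact Or.inl ⟨hL.1 u hu, hdis⟩
    · push Not at hdis
      obtain ⟨B, hBX, hBu, hBl⟩ := hdis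
      by_cases hB : ∀ v ∈ L, OnLine v B → v = u
      · exact absurd (h.eq_node u hu B hBX hBu hB ▸ hBl) hul
      · push Not at hB
        obtain ⟨v, hv, hvB, hvu⟩ := hB
        exact Or.inr ⟨hL.1 u hu, v, hL.1 v hv,
          fun hs => hvu (h.eq_of_sameLine u hu v hv hs).symm, B, hBX, hBu, hvB, hBl⟩
  · rintro hP ⟨m, hm, hPm⟩
    have hmmax : IsMaximalLine n X m := by
      rcases hm with hm | hm <;> exact hm.1
    obtain ⟨u, hu, hmu⟩ := hL.2.2 m hmmax
    have hul := hP u hu ((hmu P).1 hPm)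
    rcases hm with ⟨-, hdis⟩ | ⟨-, m', hm'max, hmm', B, -, hBm, hBm', hBl⟩
    · exact hdis (a u) (h.mem u hu) ⟨(hmu _).2 (h.onLine u hu), hul⟩
    · obtain ⟨v, hv, hmv⟩ := hL.2.2 m' hm'max
      have hB := h.eq_node_of_onLine hl hne hu hul hBl ((hmu B).1 hBm)
      rw [hB] at hBm'
      have hvu := h.eq_of_onLine u hu v hv ((hmv _).1 hBm')
      rw [hvu] at hmv
      exact hmm' (hmu.trans hmv.symm)

/-- The `l`-lowering is the Chung-Yao lattice of `l` and the maximal lines whose `1_m`-node is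
on `l`. -/
theorem isChungYao_lowering (h : CarnicerGascaIncidence X L a) {n : ℕ}
    (hL : MaximalLinesRep n X L) {l : MvPolynomial (Fin 2) ℝ} (hl : IsLinearPoly l)
    (hne : ∀ u ∈ L, ¬ SameLine l u) {k : ℕ} (hk : 1 ≤ k)
    (hcard : (L.filter (fun u => OnLine l (a u))).card = k) :
    IsChungYao (k - 1) (Lowering n X l) := by
  have hlL : l ∉ L := fun hmem => hne l hmem fun _ => Iff.rfl
  set M := insert l (L.filter (fun u => OnLine l (a u))) with hM
  have hMcard : M.card = k - 1 + 2 := by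
    rw [hM, Finset.card_insert_of_notMem (fun hmem => hlL (Finset.mem_filter.1 hmem).1), hcard]
    omega
  have hMcases : ∀ u ∈ M, u = l ∨ (u ∈ L ∧ OnLine l (a u)) := fun u hu => by
    rwa [hM, Finset.mem_insert, Finset.mem_filter] at hu
  have hMlin : ∀ u ∈ M, IsLinearPoly u := fun u hu => by
    rcases hMcases u hu with rfl | ⟨hu, -⟩
    · exact hl
    · exact h.linear u hu
  have hMne : ∀ u ∈ M, ∀ v ∈ M, u ≠ v → ¬ SameLine u v := by
    intro u hu v hv huv hs
    rcases hMcases u hu with rfl | ⟨huL, -⟩ <;> rcases hMcases v hv with rfl | ⟨hvL, -⟩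
    · exact huv rfl
    · exact hne v hvL hs
    · exact hne u huL hs.symm
    · exact huv (h.eq_of_sameLine u huL v hvL hs)
  have hMmeet : ∀ u ∈ M, ∀ v ∈ M, u ≠ v → ∃ P, OnLine u P ∧ OnLine v P := by
    intro u hu v hv huv
    rcases hMcases u hu with rfl | ⟨huL, hul⟩ <;> rcases hMcases v hv with rfl | ⟨hvL, hvl⟩
    · exact absurd rfl huv
    · exact ⟨a v, hvl, h.onLine v hvL⟩
    · exact ⟨a u, h.onLine u huL, hul⟩
    · obtain ⟨P, -, hP⟩ := h.meet u huL v hvL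
      exact ⟨P, hP⟩
  have hnode : ∀ u ∈ L, OnLine l (a u) → ∀ v ∈ L, ∀ P, OnLine l P → OnLine u P →
      OnLine v P → v = u := by
    intro u hu hul v hv P hPl hPu hPv
    rw [h.eq_node_of_onLine hl hne hu hul hPl hPu] at hPv
    exact h.eq_of_onLine u hu v hv hPv
  have hMthree : ∀ u ∈ M, ∀ v ∈ M, ∀ w ∈ M, u ≠ v → v ≠ w → u ≠ w →
      ∀ P, OnLine u P → OnLine v P → ¬ OnLine w P := by
    intro u hu v hv w hw huv hvw huw P hPu hPv hPw
    rcases hMcases u hu with rfl | ⟨huL, hul⟩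
    · obtain ⟨hvL, hvl⟩ := (hMcases v hv).resolve_left huv.symm
      obtain ⟨hwL, -⟩ := (hMcases w hw).resolve_left huw.symm
      exact hvw (hnode v hvL hvl w hwL P hPu hPv hPw).symm
    rcases hMcases v hv with rfl | ⟨hvL, hvl⟩
    · obtain ⟨hwL, -⟩ := (hMcases w hw).resolve_left hvw.symm
      exact huw (hnode u huL hul w hwL P hPv hPu hPw).symm
    rcases hMcases w hw with rfl | ⟨hwL, -⟩
    · exact huv (hnode u huL hul v hvL P hPw hPu hPv).symm
    · rcases h.eq_or_eq u huL v hvL huv P hPu hPv w hwL hPw with rfl | rfl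
      · exact huw rfl
      · exact hvw rfl
  have hMmem : ∀ P, P ∈ Lowering n X l ↔ ∃ u ∈ M, ∃ v ∈ M, u ≠ v ∧ OnLine u P ∧ OnLine v P := by
    intro P
    rw [h.mem_lowering_iff hL hl hne]
    constructor
    · rintro ⟨hPX, hP⟩
      obtain ⟨u, hu, hPu⟩ := h.cover P hPX
      have hul := hP u hu hPu
      have huM : u ∈ M := Finset.mem_insert_of_mem (Finset.mem_filter.2 ⟨hu, hul⟩)
      by_cases hPone : ∀ v ∈ L, OnLine v P → v = u
      · refine ⟨u, huM, l, Finset.mem_insert_self _ _, ?_, hPu, ?_⟩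
        · rintro rfl
          exact hlL hu
        · rwa [h.eq_node u hu P hPX hPu hPone]
      · push Not at hPone
        obtain ⟨v, hv, hPv, hvu⟩ := hPone
        exact ⟨u, huM, v, Finset.mem_insert_of_mem (Finset.mem_filter.2 ⟨hv, hP v hv hPv⟩),
          hvu.symm, hPu, hPv⟩
    · have hside : ∀ u ∈ L, OnLine l (a u) → OnLine l P → OnLine u P →
          P ∈ X ∧ ∀ v ∈ L, OnLine v P → OnLine l (a v) := by
        intro u hu hul hPl hPu
        refine ⟨?_, fun v hv hPv => ?_⟩
        · rw [h.eq_node_of_onLine hl hne hu hul hPl hPu]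
          exact h.mem u hu
        · rwa [hnode u hu hul v hv P hPl hPu hPv]
      rintro ⟨u, hu, v, hv, huv, hPu, hPv⟩
      rcases hMcases u hu with rfl | ⟨huL, hul⟩ <;> rcases hMcases v hv with rfl | ⟨hvL, hvl⟩
      · exact absurd rfl huv
      · exact hside v hvL hvl hPu hPv
      · exact hside u huL hul hPv hPu
      · refine ⟨h.mem_of_onLine huL hvL huv hPu hPv, fun w hw hPw => ?_⟩
        rcases h.eq_or_eq u huL v hvL huv P hPu hPv w hw hPw with rfl | rfl
        · exact hul
        · exact hvl
  let e : Fin (k - 1 + 2) ≃ M := (M.equivFinOfCardEq hMcard).symm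
  have he : ∀ i j, i ≠ j → (e i : MvPolynomial (Fin 2) ℝ) ≠ e j := fun i j hij heq =>
    hij (e.injective (Subtype.ext heq))
  refine ⟨fun i => e i, ⟨fun i => hMlin _ (e i).2, fun i j hij => ?_, ?_⟩, fun P => ?_⟩
  · obtain ⟨P, hPi, hPj⟩ := hMmeet _ (e i).2 _ (e j).2 (he i j hij)
    exact ⟨P, ⟨hPi, hPj⟩, fun Q hQ => eq_of_not_sameLine (hMlin _ (e i).2) (hMlin _ (e j).2)
      (hMne _ (e i).2 _ (e j).2 (he i j hij)) hQ.1 hQ.2 hPi hPj⟩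
  · rintro i j m hij hjm him ⟨P, hPi, hPj, hPm⟩
    exact hMthree _ (e i).2 _ (e j).2 _ (e m).2 (he i j hij) (he j m hjm) (he i m him)
      P hPi hPj hPm
  · rw [hMmem]
    constructor
    · rintro ⟨u, hu, v, hv, huv, hPu, hPv⟩
      refine ⟨e.symm ⟨u, hu⟩, e.symm ⟨v, hv⟩, fun hij => huv ?_, ?_, ?_⟩
      · simpa using hij
      · simpa using hPu
      · simpa using hPv
    · rintro ⟨i, j, hij, hPi, hPj⟩
      exact ⟨e i, (e i).2, e j, (e j).2, he i j hij, hPi, hPj⟩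

/-- The nodes of the `l`-lowering on `l` are the `1_m`-nodes on `l`. -/
theorem lowering_filter_eq_image (h : CarnicerGascaIncidence X L a) {n : ℕ}
    (hL : MaximalLinesRep n X L) {l : MvPolynomial (Fin 2) ℝ} (hl : IsLinearPoly l)
    (hne : ∀ u ∈ L, ¬ SameLine l u) :
    (Lowering n X l).filter (fun A => OnLine l A) =
      (L.filter (fun u => OnLine l (a u))).image a := by
  ext P
  rw [Finset.mem_filter, h.mem_lowering_iff hL hl hne, Finset.mem_image]
  constructor
  · rintro ⟨⟨hPX, hP⟩, hPl⟩
    obtain ⟨u, hu, hPu⟩ := h.cover P hPX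
    have hul := hP u hu hPu
    exact ⟨u, Finset.mem_filter.2 ⟨hu, hul⟩,
      (h.eq_node_of_onLine hl hne hu hul hPl hPu).symm⟩
  · rintro ⟨u, hu, rfl⟩
    obtain ⟨hu, hul⟩ := Finset.mem_filter.1 hu
    refine ⟨⟨h.mem u hu, fun v hv hv' => ?_⟩, hul⟩
    rwa [h.eq_of_onLine u hu v hv hv']

theorem filter_onLine_eq_pair (h : CarnicerGascaIncidence X L a) {u v : MvPolynomial (Fin 2) ℝ}
    (hu : u ∈ L) (hv : v ∈ L) (huv : u ≠ v) {P : ℝ × ℝ} (hPu : OnLine u P)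
    (hPv : OnLine v P) : L.filter (fun w => OnLine w P) = {u, v} := by
  ext w
  rw [Finset.mem_filter, Finset.mem_insert, Finset.mem_singleton]
  constructor
  · rintro ⟨hw, hPw⟩
    exact h.eq_or_eq u hu v hv huv P hPu hPv w hw hPw
  · rintro (rfl | rfl)
    · exact ⟨hu, hPu⟩
    · exact ⟨hv, hPv⟩

/-- A node uses `l` iff it is the intersection of two maximal lines whose `1_m`-nodes are
on `l`. -/
theorem uses_iff (h : CarnicerGascaIncidence X L a) {n : ℕ} (hn : 1 ≤ n) (hX : GCSet n X)
    (hL : MaximalLinesRep n X L) (hcard : L.card = n + 1) {l : MvPolynomial (Fin 2) ℝ}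
    (hl : IsLinearPoly l) (hne : ∀ u ∈ L, ¬ SameLine l u) {P : ℝ × ℝ} (hP : P ∈ X) :
    Uses n X P l ↔ ∃ u ∈ L, ∃ v ∈ L, u ≠ v ∧ OnLine u P ∧ OnLine v P ∧
      OnLine l (a u) ∧ OnLine l (a v) := by
  obtain ⟨f, hf, huses⟩ := hX.exists_coversExcept_uses_iff hP
  rw [huses l hl]
  have hfac : ∀ w ∈ L, ¬ OnLine w P → ∃ i, SameLine (f i) w := fun w hw hwP =>
    hf.exists_sameLine (hL.1 w hw) hwP
  have : Nonempty (Fin n) := ⟨⟨0, hn⟩⟩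
  choose! g hg using hfac
  set B : Finset (Fin n) := Finset.univ.filter
    (fun i => ∃ w ∈ L, ¬ OnLine w P ∧ SameLine (f i) w) with hB
  have hBcard : n + 1 ≤ B.card + (L.filter (fun w => OnLine w P)).card := by
    have hle : (L.filter (fun w => ¬ OnLine w P)).card ≤ B.card := by
      refine Finset.card_le_card_of_injOn g (fun w hw => ?_) fun w hw w' hw' hww' => ?_
      · obtain ⟨hw, hwP⟩ := Finset.mem_filter.1 hw
        exact Finset.mem_coe.2 (Finset.mem_filter.2
          ⟨Finset.mem_univ _, w, hw, hwP, hg w hw hwP⟩)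
      · obtain ⟨hw, hwP⟩ := Finset.mem_filter.1 hw
        obtain ⟨hw', hwP'⟩ := Finset.mem_filter.1 hw'
        have hgw' := hg w' hw' hwP'
        rw [← hww'] at hgw'
        exact h.eq_of_sameLine w hw w' hw' ((hg w hw hwP).symm.trans hgw')
    have := Finset.card_filter_add_card_filter_not (s := L) (fun w => OnLine w P)
    omega
  have hBne : ∀ i ∈ B, ¬ SameLine (f i) l := by
    intro i hi hs
    obtain ⟨-, w, hw, -, hiw⟩ := Finset.mem_filter.1 hi
    exact hne w hw (hs.symm.trans hiw)
  by_cases hone : (L.filter (fun w => OnLine w P)).card ≤ 1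
  · constructor
    · rintro ⟨i, hi⟩
      have huniv : B = Finset.univ := by
        apply Finset.eq_univ_of_card
        have := Finset.card_le_univ B
        rw [Fintype.card_fin] at this ⊢
        omega
      exact absurd hi (hBne i (huniv ▸ Finset.mem_univ i))
    · rintro ⟨u, hu, v, hv, huv, hPu, hPv, -⟩
      exact absurd (Finset.card_le_one.1 hone u (Finset.mem_filter.2 ⟨hu, hPu⟩) v
        (Finset.mem_filter.2 ⟨hv, hPv⟩)) huv
  · obtain ⟨u, hu, v, hv, huv⟩ := Finset.one_lt_card.1 (not_le.1 hone)
    rw [Finset.mem_filter] at hu hv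
    obtain ⟨hu, hPu⟩ := hu
    obtain ⟨hv, hPv⟩ := hv
    have hpair := h.filter_onLine_eq_pair hu hv huv hPu hPv
    have hcompl : Bᶜ.card ≤ 1 := by
      rw [Finset.card_compl, Fintype.card_fin]
      rw [hpair, Finset.card_pair huv] at hBcard
      omega
    have heq := Finset.card_le_one.1 hcompl
    have hnot : ∀ w ∈ L, OnLine w P → ∀ i, OnLine (f i) (a w) → i ∈ Bᶜ := by
      intro w hw hPw i hi
      rw [Finset.mem_compl]
      intro hiB
      obtain ⟨-, z, hz, hPz, hiz⟩ := Finset.mem_filter.1 hiB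
      rw [h.eq_of_onLine w hw z hz ((hiz _).1 hi)] at hPz
      exact hPz hPw
    have hau : a u ≠ P := by
      rintro rfl
      exact huv (h.eq_of_onLine u hu v hv hPv).symm
    have hav : a v ≠ P := by
      rintro rfl
      exact huv (h.eq_of_onLine v hv u hu hPu)
    obtain ⟨i, hi⟩ := hf.cover (a u) (h.mem u hu) hau
    obtain ⟨j, hj⟩ := hf.cover (a v) (h.mem v hv) hav
    have hiB := hnot u hu hPu i hi
    obtain rfl := heq i hiB j (hnot v hv hPv j hj)
    constructor
    · rintro ⟨m, hm⟩
      obtain rfl := heq m (Finset.mem_compl.2 fun hmB => hBne m hmB hm) i hiB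
      exact ⟨u, hu, v, hv, huv, hPu, hPv, (hm _).1 hi, (hm _).1 hj⟩
    · rintro ⟨u', hu', v', hv', huv', hPu', hPv', hlu, hlv⟩
      have hon : ∀ w ∈ L, OnLine w P → OnLine (f i) (a w) := fun w hw hPw => by
        rcases h.eq_or_eq u hu v hv huv P hPu hPv w hw hPw with rfl | rfl
        · exact hi
        · exact hj
      exact ⟨i, sameLine_of_two_points (hf.linear i) hl
        (fun haa => huv' (h.injOn hu' hv' haa)) (hon u' hu' hPu') (hon v' hv' hPv') hlu hlv⟩

theorem card_usedSet (h : CarnicerGascaIncidence X L a) {n : ℕ} (hn : 1 ≤ n) (hX : GCSet n X)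
    (hL : MaximalLinesRep n X L) (hcard : L.card = n + 1) {l : MvPolynomial (Fin 2) ℝ}
    (hl : IsLinearPoly l) (hne : ∀ u ∈ L, ¬ SameLine l u) :
    (UsedSet n X l).card = (L.filter (fun u => OnLine l (a u))).card.choose 2 := by
  rw [← Finset.card_powersetCard]
  have hmem : ∀ P ∈ UsedSet n X l, ∃ u ∈ L, ∃ v ∈ L, u ≠ v ∧ OnLine u P ∧ OnLine v P ∧
      OnLine l (a u) ∧ OnLine l (a v) := fun P hP => by
    obtain ⟨hPX, hP⟩ := Finset.mem_filter.1 hP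
    exact (h.uses_iff hn hX hL hcard hl hne hPX).1 hP
  refine Finset.card_bij (fun P _ => L.filter (fun w => OnLine w P)) ?_ ?_ ?_
  · intro P hP
    obtain ⟨u, hu, v, hv, huv, hPu, hPv, hul, hvl⟩ := hmem P hP
    rw [Finset.mem_powersetCard, h.filter_onLine_eq_pair hu hv huv hPu hPv]
    refine ⟨?_, Finset.card_pair huv⟩
    intro w hw
    rw [Finset.mem_insert, Finset.mem_singleton] at hw
    rcases hw with rfl | rfl
    · exact Finset.mem_filter.2 ⟨hu, hul⟩
    · exact Finset.mem_filter.2 ⟨hv, hvl⟩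
  · intro P hP Q hQ hPQ
    obtain ⟨u, hu, v, hv, huv, hPu, hPv, -⟩ := hmem P hP
    have hQon : ∀ w ∈ L, OnLine w P → OnLine w Q := fun w hw hPw => by
      have hmemP : w ∈ L.filter (fun w => OnLine w P) := Finset.mem_filter.2 ⟨hw, hPw⟩
      rw [hPQ] at hmemP
      exact (Finset.mem_filter.1 hmemP).2
    exact h.point_eq hu hv huv hPu hPv (hQon u hu hPu) (hQon v hv hPv)
  · intro s hs
    obtain ⟨hsub, hs2⟩ := Finset.mem_powersetCard.1 hs
    obtain ⟨u, v, huv, rfl⟩ := Finset.card_eq_two.1 hs2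
    obtain ⟨hu, hul⟩ := Finset.mem_filter.1 (hsub (Finset.mem_insert_self u {v}))
    obtain ⟨hv, hvl⟩ := Finset.mem_filter.1
      (hsub (Finset.mem_insert_of_mem (Finset.mem_singleton_self v)))
    obtain ⟨P, hPX, hPu, hPv⟩ := h.meet u hu v hv
    exact ⟨P, Finset.mem_filter.2 ⟨hPX, (h.uses_iff hn hX hL hcard hl hne hPX).2
      ⟨u, hu, v, hv, huv, hPu, hPv, hul, hvl⟩⟩, h.filter_onLine_eq_pair hu hv huv hPu hPv⟩

end CarnicerGascaIncidence

/-- In a Carnicer-Gasca lattice (a `GC_n` set with exactly `n+1` maximal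
lines), if a line `l` passes through exactly `k ≥ 2` of the `1_m`-nodes, then the
`l`-lowering is a Chung-Yao lattice of degree `k-1` in which `l` is maximal, and `l`
is used by exactly `k(k-1)/2` nodes of `X`. -/
theorem carnicer_gasca_proper_line
    (n k : ℕ) (hn : 2 ≤ n) (hk2 : 2 ≤ k) (X : Finset (ℝ × ℝ)) (hX : GCSet n X)
    (L : Finset (MvPolynomial (Fin 2) ℝ)) (hL : MaximalLinesRep n X L)
    (hcardL : L.card = n + 1)
    (l : MvPolynomial (Fin 2) ℝ) (hl : IsLinearPoly l)
    (hk : (X.filter (fun A => OnLine l A ∧ Is1mNode L A)).card = k) :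
    IsChungYao (k - 1) (Lowering n X l) ∧
    IsMaximalLine (k - 1) (Lowering n X l) l ∧
    (UsedSet n X l).card = k * (k - 1) / 2 := by
  obtain ⟨a, h⟩ := hX.exists_carnicerGascaIncidence (by omega) hL hcardL
  have hK : (L.filter (fun u => OnLine l (a u))).card = k := by rw [← h.card_filter_eq, hk]
  have hne := h.not_sameLine (l := l) (hK ▸ hk2)
  refine ⟨h.isChungYao_lowering hL hl hne (by omega) hK, ⟨hl, ?_⟩, ?_⟩
  · rw [h.lowering_filter_eq_image hL hl hne, ← h.filter_eq_image, hk]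
    omega
  · rw [h.card_usedSet (by omega) hX hL hcardL hl hne, hK, Nat.choose_two_right]
end

section
/- The Chung-Yao lattice formed by the intersection points of n+2 lines in general position is a GC_n set, with the fundamental polynomial of each node being the product of the n lines not passing through it. -/
attribute [local instance] Classical.propDecidable

theorem evalPt_smul (c : ℝ) (p : MvPolynomial (Fin 2) ℝ) (A : ℝ × ℝ) :
    evalPt (c • p) A = c * evalPt p A :=
  MvPolynomial.smul_eval _ p c

/-- Evaluation at the points of `X`, as a linear map on polynomials of degree at most `n`. -/
noncomputable def evalNodes (n : ℕ) (X : Finset (ℝ × ℝ)) :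
    MvPolynomial.restrictTotalDegree (Fin 2) ℝ n →ₗ[ℝ] (X → ℝ) where
  toFun p A := evalPt p.1 A.1
  map_add' p q := by ext A; exact map_add (MvPolynomial.eval _) _ _
  map_smul' c p := by ext A; exact evalPt_smul c p.1 A.1

theorem finrank_restrictTotalDegree_fin_two_le (n : ℕ) :
    Module.finrank ℝ (MvPolynomial.restrictTotalDegree (Fin 2) ℝ n) ≤ (n + 2).choose 2 := by
  let S : Set (Fin 2 →₀ ℕ) := {s | (s.sum fun _ e => e) ≤ n}
  let T : Finset (Σ _ : ℕ, ℕ) := (Finset.range (n + 1)).sigma fun t => Finset.range (t + 1)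
  have hsum : ∀ s ∈ S, s 0 + s 1 ≤ n := by
    intro s hs
    have h : (s.sum fun _ e => e) ≤ n := hs
    rwa [Finsupp.sum_fintype _ _ (fun _ => rfl), Fin.sum_univ_two] at h
  let g : S → T := fun s => ⟨⟨s.1 0 + s.1 1, s.1 0⟩, by
    have := hsum s.1 s.2
    simp only [T, Finset.mem_sigma, Finset.mem_range]
    omega⟩
  have hg : Function.Injective g := by
    intro s t h
    have h' := congrArg Subtype.val h
    simp only [g, Sigma.mk.injEq, heq_eq_eq] at h'
    ext i
    fin_cases i
    · exact h'.2
    · have := h'.1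
      have := h'.2
      change s.1 1 = t.1 1
      omega
  have hT : T.card = (n + 2).choose 2 := by
    simpa [T, Finset.card_sigma] using Nat.sum_range_add_choose n 1
  calc Module.finrank ℝ (MvPolynomial.restrictTotalDegree (Fin 2) ℝ n)
      = Nat.card S := Module.finrank_eq_nat_card_basis (MvPolynomial.basisRestrictSupport ℝ S)
    _ ≤ Nat.card T := Nat.card_le_card_of_injective g hg
    _ = (n + 2).choose 2 := by rw [Nat.card_eq_fintype_card, Fintype.card_coe, hT]

/-- If every point of `X` has a fundamental polynomial and `X` has as many points as the space
of polynomials of degree at most `n` has dimensions, then `X` is `n`-correct. -/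
theorem nCorrect_of_isFundamental {n : ℕ} {X : Finset (ℝ × ℝ)} (hcard : X.card = (n + 2).choose 2)
    (hfund : ∀ A ∈ X, ∃ p, IsFundamental n X A p) : NCorrect n X := by
  choose! p hp using hfund
  have hinterp : ∀ c : ℝ × ℝ → ℝ, ∃ q : MvPolynomial (Fin 2) ℝ,
      q.totalDegree ≤ n ∧ ∀ A ∈ X, evalPt q A = c A := by
    intro c
    refine ⟨∑ A ∈ X, c A • p A, ?_, fun B hB => ?_⟩
    · exact MvPolynomial.totalDegree_finsetSum_le fun A hA =>
        (MvPolynomial.totalDegree_smul_le _ _).trans (hp A hA).1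
    · have : evalPt (∑ A ∈ X, c A • p A) B = ∑ A ∈ X, c A * evalPt (p A) B := by
        simp only [← evalPt_smul]
        exact map_sum (MvPolynomial.eval ![B.1, B.2]) _ _
      rw [this, Finset.sum_eq_single_of_mem B hB, (hp B hB).2.1, mul_one]
      intro A hA hAB
      rw [(hp A hA).2.2 B hB hAB.symm, mul_zero]
  have hsurj : Function.Surjective (evalNodes n X) := by
    intro c
    obtain ⟨q, hq, hqc⟩ := hinterp fun A => if h : A ∈ X then c ⟨A, h⟩ else 0
    refine ⟨⟨q, (MvPolynomial.mem_restrictTotalDegree _ _ _).2 hq⟩, ?_⟩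
    ext A
    exact (hqc A.1 A.2).trans (dif_pos A.2)
  have hrank : Module.finrank ℝ (MvPolynomial.restrictTotalDegree (Fin 2) ℝ n) =
      Module.finrank ℝ (X → ℝ) := by
    refine le_antisymm ?_ (LinearMap.finrank_le_finrank_of_surjective hsurj)
    rw [Module.finrank_fintype_fun_eq_card, Fintype.card_coe, hcard]
    exact finrank_restrictTotalDegree_fin_two_le n
  have hinj : Function.Injective (evalNodes n X) :=
    (LinearMap.injective_iff_surjective_of_finrank_eq_finrank hrank).2 hsurj
  refine ⟨by rw [hcard, Nat.choose_two_right]; rfl, fun c => ?_⟩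
  obtain ⟨q, hq, hqc⟩ := hinterp c
  refine ⟨q, ⟨hq, hqc⟩, fun r hr => ?_⟩
  refine congrArg Subtype.val (@hinj
    ⟨r, (MvPolynomial.mem_restrictTotalDegree _ _ _).2 hr.1⟩
    ⟨q, (MvPolynomial.mem_restrictTotalDegree _ _ _).2 hq⟩ ?_)
  ext A
  exact (hr.2 A.1 A.2).trans (hqc A.1 A.2).symm

/-- The indices of the lines of the family `f` passing through `A`. -/
noncomputable def linesThrough {k : ℕ} (f : Fin k → MvPolynomial (Fin 2) ℝ) (A : ℝ × ℝ) :
    Finset (Fin k) :=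
  Finset.univ.filter fun i => OnLine (f i) A

theorem mem_linesThrough {k : ℕ} {f : Fin k → MvPolynomial (Fin 2) ℝ} {A : ℝ × ℝ} {i : Fin k} :
    i ∈ linesThrough f A ↔ OnLine (f i) A := by
  simp [linesThrough]

namespace InGenPos

variable {k : ℕ} {f : Fin k → MvPolynomial (Fin 2) ℝ}

theorem linesThrough_eq_pair (hf : InGenPos k f) {A : ℝ × ℝ} {i j : Fin k} (hij : i ≠ j)
    (hi : OnLine (f i) A) (hj : OnLine (f j) A) : linesThrough f A = {i, j} := by
  ext m
  rw [mem_linesThrough, Finset.mem_insert, Finset.mem_singleton]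
  refine ⟨fun hm => ?_, ?_⟩
  · by_contra! h
    exact hf.2.2 i j m hij h.2.symm h.1.symm ⟨A, hi, hj, hm⟩
  · rintro (rfl | rfl) <;> assumption

theorem card_linesThrough (hf : InGenPos k f) {A : ℝ × ℝ}
    (hA : ∃ i j, i ≠ j ∧ OnLine (f i) A ∧ OnLine (f j) A) : (linesThrough f A).card = 2 := by
  obtain ⟨i, j, hij, hi, hj⟩ := hA
  rw [hf.linesThrough_eq_pair hij hi hj, Finset.card_pair hij]

theorem eq_of_linesThrough_subset (hf : InGenPos k f) {A B : ℝ × ℝ}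
    (hA : ∃ i j, i ≠ j ∧ OnLine (f i) A ∧ OnLine (f j) A)
    (h : linesThrough f A ⊆ linesThrough f B) : A = B := by
  obtain ⟨i, j, hij, hi, hj⟩ := hA
  exact (hf.2.1 i j hij).unique ⟨hi, hj⟩
    ⟨mem_linesThrough.1 (h (mem_linesThrough.2 hi)), mem_linesThrough.1 (h (mem_linesThrough.2 hj))⟩

theorem card_intersections (hf : InGenPos k f) {X : Finset (ℝ × ℝ)}
    (hX : ∀ P : ℝ × ℝ, P ∈ X ↔ ∃ i j, i ≠ j ∧ OnLine (f i) P ∧ OnLine (f j) P) :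
    X.card = k.choose 2 := by
  have : X.card = (Finset.powersetCard 2 (Finset.univ : Finset (Fin k))).card := by
    refine Finset.card_bij (fun A _ => linesThrough f A) (fun A hA => ?_) (fun A hA B _ h => ?_)
      (fun s hs => ?_)
    · exact Finset.mem_powersetCard.2
        ⟨Finset.subset_univ _, hf.card_linesThrough ((hX A).1 hA)⟩
    · exact hf.eq_of_linesThrough_subset ((hX A).1 hA) h.subset
    · obtain ⟨i, j, hij, rfl⟩ := Finset.card_eq_two.1 (Finset.mem_powersetCard.1 hs).2
      obtain ⟨A, ⟨hi, hj⟩, -⟩ := hf.2.1 i j hij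
      exact ⟨A, (hX A).2 ⟨i, j, hij, hi, hj⟩, hf.linesThrough_eq_pair hij hi hj⟩
  rw [this, Finset.card_powersetCard, Finset.card_fin]

theorem isFundamental_smul_prod {n : ℕ} {f : Fin (n + 2) → MvPolynomial (Fin 2) ℝ}
    (hf : InGenPos (n + 2) f) {X : Finset (ℝ × ℝ)}
    (hX : ∀ P : ℝ × ℝ, P ∈ X ↔ ∃ i j, i ≠ j ∧ OnLine (f i) P ∧ OnLine (f j) P)
    {A : ℝ × ℝ} (hA : A ∈ X) :
    IsFundamental n X A ((∏ i ∈ (linesThrough f A)ᶜ, evalPt (f i) A)⁻¹ •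
      ∏ i ∈ (linesThrough f A)ᶜ, f i) := by
  refine ⟨?_, ?_, fun B hB hBA => ?_⟩
  · refine (MvPolynomial.totalDegree_smul_le _ _).trans
      ((MvPolynomial.totalDegree_finsetProd _ _).trans ?_)
    rw [Finset.sum_congr rfl fun i _ => hf.1 i, Finset.sum_const, Finset.card_compl,
      hf.card_linesThrough ((hX A).1 hA)]
    simp
  · rw [evalPt_smul, evalPt_prod]
    refine inv_mul_cancel₀ (Finset.prod_ne_zero_iff.2 fun i hi h => ?_)
    exact Finset.mem_compl.1 hi (mem_linesThrough.2 h)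
  · have : ¬ linesThrough f B ⊆ linesThrough f A := fun h =>
      hBA (hf.eq_of_linesThrough_subset ((hX B).1 hB) h)
    obtain ⟨i, hiB, hiA⟩ := Finset.not_subset.1 this
    have hzero : evalPt (f i) B = 0 := mem_linesThrough.1 hiB
    rw [evalPt_smul, evalPt_prod]
    exact mul_eq_zero_of_right _ (Finset.prod_eq_zero (Finset.mem_compl.2 hiA) hzero)

end InGenPos

theorem IsLinearPoly.smul {l : MvPolynomial (Fin 2) ℝ} (hl : IsLinearPoly l) {c : ℝ}
    (hc : c ≠ 0) : IsLinearPoly (c • l) := by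
  rw [IsLinearPoly, MvPolynomial.totalDegree, MvPolynomial.support_smul_eq hc]
  exact hl

/-- A fundamental polynomial that is a multiple of a product of `n` lines is a product of
`n` lines. -/
theorem IsFundamental.exists_eq_prod {n : ℕ} {X : Finset (ℝ × ℝ)} {A : ℝ × ℝ} {ι : Type*}
    {s : Finset ι} (hs : s.card = n) {f : ι → MvPolynomial (Fin 2) ℝ}
    (hf : ∀ i, IsLinearPoly (f i)) {c : ℝ} (h : IsFundamental n X A (c • ∏ i ∈ s, f i)) :
    ∃ g : Fin n → MvPolynomial (Fin 2) ℝ,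
      (∀ i, IsLinearPoly (g i)) ∧ IsFundamental n X A (∏ i, g i) := by
  have hc : c ≠ 0 := by
    rintro rfl
    have := h.2.1
    rw [evalPt_smul, zero_mul] at this
    exact zero_ne_one this
  let e : Fin n ≃ s := (s.equivFinOfCardEq hs).symm
  have hprod : ∏ i ∈ s, f i = ∏ i : Fin n, f (e i) := by
    rw [← Finset.prod_coe_sort, ← e.prod_comp]
  cases n with
  | zero =>
    refine ⟨Fin.elim0, fun i => i.elim0, ?_, ?_, ?_⟩
    · simp
    · simp [evalPt]
    · intro B hB hBA
      have := h.2.2 B hB hBA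
      rw [hprod, evalPt_smul] at this
      simp [evalPt, hc] at this
  | succ n =>
    refine ⟨Fin.cons (c • f (e 0)) fun i => f (e i.succ), ?_, ?_⟩
    · refine Fin.cases ?_ fun i => ?_
      · exact (hf _).smul hc
      · exact hf _
    · rw [Fin.prod_cons, smul_mul_assoc, ← Fin.prod_univ_succ (fun i => f (e i)), ← hprod]
      exact h

/-- The Chung-Yao lattice of `n+2` lines in general position is a `GC_n`
set, the fundamental polynomial of each node being (a normalization of) the product of
the `n` lines not passing through it. -/
theorem chung_yao_is_GC
    (n : ℕ) (f : Fin (n + 2) → MvPolynomial (Fin 2) ℝ) (hf : InGenPos (n + 2) f)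
    (X : Finset (ℝ × ℝ))
    (hXmem : ∀ P : ℝ × ℝ, P ∈ X ↔ ∃ i j, i ≠ j ∧ OnLine (f i) P ∧ OnLine (f j) P) :
    GCSet n X ∧
    ∀ A ∈ X, ∃ c : ℝ,
      IsFundamental n X A
        (c • ∏ i ∈ Finset.univ.filter (fun i => ¬ OnLine (f i) A), f i) := by
  have hfund : ∀ A ∈ X, _ := fun A hA => hf.isFundamental_smul_prod hXmem hA
  refine ⟨⟨?_, fun A hA => ?_⟩, fun A hA => ?_⟩
  · exact nCorrect_of_isFundamental (hf.card_intersections hXmem) fun A hA => ⟨_, hfund A hA⟩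
  · refine (hfund A hA).exists_eq_prod ?_ hf.1
    rw [Finset.card_compl, hf.card_linesThrough ((hXmem A).1 hA), Fintype.card_fin,
      Nat.add_sub_cancel]
  · have := hfund A hA
    rw [linesThrough, Finset.compl_filter] at this
    exact ⟨_, this⟩
end
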